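/- There exists a universal constant α ∈ (0,1/2) such that for all b ∈ [0,1], α(b−1)² ≤ |g(b)| ≤ (1/2)(b−1)². -/

import Mathlib

open MeasureTheory Filter Set

noncomputable section

/-- The canonical 2D magnetic potential `A₀(x) = (-x₂/2, x₁/2)`. -/
def A0 (x : ℝ × ℝ) : ℝ × ℝ := (-x.2 / 2, x.1 / 2)

/-- The open square `K_R = (-R/2, R/2) × (-R/2, R/2)` in `ℝ²`. -/
def KR (R : ℝ) : Set (ℝ × ℝ) := Ioo (-R/2) (R/2) ×ˢ Ioo (-R/2) (R/2)

/-- First component of the magnetic gradient `(∇ - iA₀)u`. -/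
def D1 (u : ℝ × ℝ → ℂ) (x : ℝ × ℝ) : ℂ :=
  fderiv ℝ u x (1, 0) - Complex.I * ((A0 x).1 : ℂ) * u x

/-- Second component of the magnetic gradient `(∇ - iA₀)u`. -/
def D2 (u : ℝ × ℝ → ℂ) (x : ℝ × ℝ) : ℂ :=
  fderiv ℝ u x (0, 1) - Complex.I * ((A0 x).2 : ℂ) * u x

/-- The two-dimensional Ginzburg–Landau energy `G_{b,K_R}(u)`. -/
def G2 (b R : ℝ) (u : ℝ × ℝ → ℂ) : ℝ :=
  ∫ x in KR R, (b * (‖D1 u x‖ ^ 2 + ‖D2 u x‖ ^ 2) - ‖u x‖ ^ 2 + (1/2) * ‖u x‖ ^ 4)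

/-- `m₀(b,R)`: the ground state energy of `G_{b,K_R}` with Dirichlet boundary conditions,
realized (by density) as the infimum over smooth functions compactly supported in `K_R`. -/
def m0 (b R : ℝ) : ℝ :=
  sInf {E : ℝ | ∃ u : ℝ × ℝ → ℂ, ContDiff ℝ (⊤ : ℕ∞) u ∧ HasCompactSupport u ∧
    tsupport u ⊆ KR R ∧ E = G2 b R u}

/-- The magnetic periodicity conditions defining the space `E_R`. -/
def MagPeriodic (R : ℝ) (u : ℝ × ℝ → ℂ) : Prop :=
  ∀ x : ℝ × ℝ,
    u (x.1 + R, x.2) = Complex.exp (Complex.I * (R * x.2 / 2)) * u x ∧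
    u (x.1, x.2 + R) = Complex.exp (-(Complex.I * (R * x.1 / 2))) * u x

/-- `m_p(b,R)`: the ground state energy of `G_{b,K_R}` over the magnetically periodic space
`E_R`, realized (by elliptic regularity/density) over smooth magnetic periodic functions. -/
def mp (b R : ℝ) : ℝ :=
  sInf {E : ℝ | ∃ u : ℝ × ℝ → ℂ, ContDiff ℝ (⊤ : ℕ∞) u ∧ MagPeriodic R u ∧ E = G2 b R u}

/-- The lowest Landau band equation `(∂₁ + i∂₂ + (1/2)(x₁ + ix₂))u = 0`. -/
def LLL (u : ℝ × ℝ → ℂ) : Prop :=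
  ∀ x : ℝ × ℝ,
    fderiv ℝ u x (1, 0) + Complex.I * fderiv ℝ u x (0, 1)
      + (1/2 : ℂ) * ((x.1 : ℂ) + Complex.I * (x.2 : ℂ)) * u x = 0

/-- The Abrikosov energy `F_R(v) = ∫_{K_R} (-|v|² + (1/2)|v|⁴)`. -/
def FAb (R : ℝ) (v : ℝ × ℝ → ℂ) : ℝ :=
  ∫ x in KR R, (-‖v x‖ ^ 2 + (1/2) * ‖v x‖ ^ 4)

/-- `c(R)`: the minimal Abrikosov energy over the lowest Landau band `L_R`. -/
def cAb (R : ℝ) : ℝ :=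
  sInf {E : ℝ | ∃ u : ℝ × ℝ → ℂ, ContDiff ℝ (⊤ : ℕ∞) u ∧ MagPeriodic R u ∧ LLL u ∧ E = FAb R u}

/-- The thermodynamic limit function `g(b) = lim_{R→∞} m₀(b,R)/R²`. -/
def gfun (b : ℝ) : ℝ := limUnder atTop (fun R : ℝ => m0 b R / R ^ 2)

/-- The canonical 3D magnetic potential `F(x) = (-x₂/2, x₁/2, 0)`. -/
def Fpot (x : ℝ × ℝ × ℝ) : ℝ × ℝ × ℝ := (-x.2.1 / 2, x.1 / 2, 0)

/-- The open cube `Q_R = (-R/2, R/2)³` in `ℝ³`. -/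
def QR (R : ℝ) : Set (ℝ × ℝ × ℝ) :=
  Ioo (-R/2) (R/2) ×ˢ Ioo (-R/2) (R/2) ×ˢ Ioo (-R/2) (R/2)

/-- First component of the 3D magnetic gradient `(∇ - iF)u`. -/
def DD1 (u : ℝ × ℝ × ℝ → ℂ) (x : ℝ × ℝ × ℝ) : ℂ :=
  fderiv ℝ u x (1, 0, 0) - Complex.I * ((Fpot x).1 : ℂ) * u x

/-- Second component of the 3D magnetic gradient `(∇ - iF)u`. -/
def DD2 (u : ℝ × ℝ × ℝ → ℂ) (x : ℝ × ℝ × ℝ) : ℂ :=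
  fderiv ℝ u x (0, 1, 0) - Complex.I * ((Fpot x).2.1 : ℂ) * u x

/-- Third component of the 3D magnetic gradient `(∇ - iF)u`. -/
def DD3 (u : ℝ × ℝ × ℝ → ℂ) (x : ℝ × ℝ × ℝ) : ℂ :=
  fderiv ℝ u x (0, 0, 1) - Complex.I * ((Fpot x).2.2 : ℂ) * u x

/-- The three-dimensional Ginzburg–Landau energy `F³ᴰ_{b,Q_R}(u)`. -/
def G3 (b R : ℝ) (u : ℝ × ℝ × ℝ → ℂ) : ℝ :=
  ∫ x in QR R, (b * (‖DD1 u x‖ ^ 2 + ‖DD2 u x‖ ^ 2 + ‖DD3 u x‖ ^ 2)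
    - ‖u x‖ ^ 2 + (1/2) * ‖u x‖ ^ 4)

/-- `M₀(b,R)`: the 3D ground state energy with Dirichlet boundary conditions. -/
def M0 (b R : ℝ) : ℝ :=
  sInf {E : ℝ | ∃ u : ℝ × ℝ × ℝ → ℂ, ContDiff ℝ (⊤ : ℕ∞) u ∧ HasCompactSupport u ∧
    tsupport u ⊆ QR R ∧ E = G3 b R u}

end

/-- The annihilation operator `(∂₁ + i∂₂ + (1/2)(x₁ + ix₂))`, equal to `D1 + i D2`. -/
noncomputable def dbarA (u : ℝ × ℝ → ℂ) (x : ℝ × ℝ) : ℂ :=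
  fderiv ℝ u x (1, 0) + Complex.I * fderiv ℝ u x (0, 1)
    + (1/2 : ℂ) * ((x.1 : ℂ) + Complex.I * (x.2 : ℂ)) * u x

/-- Smooth functions with compact support contained in `U`. -/
structure TestOn (U : Set (ℝ × ℝ)) (u : ℝ × ℝ → ℂ) : Prop where
  smooth : ContDiff ℝ (⊤ : ℕ∞) u
  compact : HasCompactSupport u
  supp : tsupport u ⊆ U

theorem integrable_of_vanish {f : ℝ × ℝ → ℝ} {K : Set (ℝ × ℝ)} (hK : IsCompact K)
    (hf : Continuous f) (h : ∀ x ∉ K, f x = 0) : Integrable f :=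
  hf.integrable_of_hasCompactSupport (HasCompactSupport.intro hK h)

theorem integral_lineDeriv_eq_zero {X X' : ℝ × ℝ → ℝ} {K : Set (ℝ × ℝ)} {v : ℝ × ℝ}
    (hK : IsCompact K) (hX : Continuous X) (hX' : Continuous X') (h : ∀ x ∉ K, X x = 0)
    (h' : ∀ x ∉ K, X' x = 0) (hd : ∀ x, HasLineDerivAt ℝ X (X' x) x v) :
    ∫ x, X' x = 0 := by
  have key := integral_bilinear_hasLineDerivAt_right_eq_neg_left_of_integrable
    (μ := (volume : Measure (ℝ × ℝ))) (f := fun _ => (1 : ℝ)) (f' := fun _ => (0 : ℝ))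
    (g := X) (g' := X') (v := v) (B := ContinuousLinearMap.mul ℝ ℝ)
    (by simp) (by simpa using integrable_of_vanish hK hX' h')
    (by simpa using integrable_of_vanish hK hX h)
    (fun x _ => by simpa [HasLineDerivAt] using hasDerivAt_const (0 : ℝ) (1 : ℝ))
    (fun x _ => hd x)
  simpa using key

section TestFunctions

variable {U : Set (ℝ × ℝ)} {u : ℝ × ℝ → ℂ}

theorem continuous_fderiv_apply_const (hu : ContDiff ℝ (⊤ : ℕ∞) u) (v : ℝ × ℝ) :
    Continuous fun x => fderiv ℝ u x v :=
  (hu.continuous_fderiv (by simp)).clm_apply continuous_const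

theorem contDiff_fderiv_apply_const (hu : ContDiff ℝ (⊤ : ℕ∞) u) (v : ℝ × ℝ) :
    ContDiff ℝ (⊤ : ℕ∞) fun x => fderiv ℝ u x v :=
  (hu.fderiv_right (m := (⊤ : ℕ∞)) (by simp)).clm_apply contDiff_const

theorem continuous_dbarA (hu : ContDiff ℝ (⊤ : ℕ∞) u) : Continuous (dbarA u) := by
  have h1 := continuous_fderiv_apply_const hu (1, 0)
  have h2 := continuous_fderiv_apply_const hu (0, 1)
  have h3 := hu.continuous
  unfold dbarA
  fun_prop

theorem fderiv_eq_zero_of_notMem_tsupport {x : ℝ × ℝ} (hx : x ∉ tsupport u) :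
    fderiv ℝ u x = 0 := by
  by_contra h
  exact hx (support_fderiv_subset ℝ h)

theorem dbarA_eq_zero_of_notMem_tsupport {x : ℝ × ℝ} (hx : x ∉ tsupport u) :
    dbarA u x = 0 := by
  simp [dbarA, fderiv_eq_zero_of_notMem_tsupport hx, image_eq_zero_of_notMem_tsupport hx]

theorem fderiv_fderiv_symm (hu : ContDiff ℝ (⊤ : ℕ∞) u) (x v w : ℝ × ℝ) :
    fderiv ℝ (fun y => fderiv ℝ u y v) x w = fderiv ℝ (fun y => fderiv ℝ u y w) x v := by
  have hd : DifferentiableAt ℝ (fderiv ℝ u) x :=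
    ((hu.fderiv_right (m := (⊤ : ℕ∞)) (by simp)).differentiable (by simp)) x
  have hs := second_derivative_symmetric (𝕜 := ℝ) (f := u) (f' := fderiv ℝ u) (x := x)
    (fun y => (hu.differentiable (by simp) y).hasFDerivAt) hd.hasFDerivAt w v
  have e : ∀ v : ℝ × ℝ, fderiv ℝ (fun y => fderiv ℝ u y v) x
      = (ContinuousLinearMap.apply ℝ ℂ v).comp (fderiv ℝ (fderiv ℝ u) x) := fun v =>
    ((ContinuousLinearMap.apply ℝ ℂ v).hasFDerivAt.comp x hd.hasFDerivAt).fderiv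
  rw [e, e]
  simpa using hs

theorem hasDerivAt_line_re_im (hu : ContDiff ℝ (⊤ : ℕ∞) u) (x v : ℝ × ℝ) :
    HasDerivAt (fun t : ℝ => (u (x + t • v)).re) (fderiv ℝ u x v).re 0 ∧
    HasDerivAt (fun t : ℝ => (u (x + t • v)).im) (fderiv ℝ u x v).im 0 := by
  have h : HasDerivAt (fun t : ℝ => u (x + t • v)) (fderiv ℝ u x v) 0 :=
    ((hu.differentiable (by simp) x).hasFDerivAt.hasLineDerivAt v)
  exact ⟨Complex.reCLM.hasFDerivAt.comp_hasDerivAt 0 h,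
    Complex.imCLM.hasFDerivAt.comp_hasDerivAt 0 h⟩

/-- The commutator identity: the kinetic energy minus `‖dbarA u‖²` and `‖u‖²` is a divergence. -/
theorem integral_kinetic_sub (hu : ContDiff ℝ (⊤ : ℕ∞) u) (hc : HasCompactSupport u) :
    ∫ x, (‖D1 u x‖ ^ 2 + ‖D2 u x‖ ^ 2 - ‖dbarA u x‖ ^ 2 - ‖u x‖ ^ 2) = 0 := by
  set a := fun x => fderiv ℝ u x (1, 0) with ha
  set c := fun x => fderiv ℝ u x (0, 1) with hcc
  have hac : ContDiff ℝ (⊤ : ℕ∞) a := contDiff_fderiv_apply_const hu _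
  have hccd : ContDiff ℝ (⊤ : ℕ∞) c := contDiff_fderiv_apply_const hu _
  set X1 : ℝ × ℝ → ℝ := fun x => (u x).im * (c x).re - (u x).re * (c x).im
    + x.1 / 2 * ((u x).re * (u x).re + (u x).im * (u x).im) with hX1
  set X2 : ℝ × ℝ → ℝ := fun x => -((u x).im * (a x).re - (u x).re * (a x).im)
    + x.2 / 2 * ((u x).re * (u x).re + (u x).im * (u x).im) with hX2
  set d := fun x => fderiv ℝ c x (1, 0) with hd
  have hda : ∀ x, fderiv ℝ a x (0, 1) = d x := fun x => fderiv_fderiv_symm hu x _ _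
  have hdd : Continuous d := continuous_fderiv_apply_const hccd _
  have cu := hu.continuous
  have ca := hac.continuous
  have ccn := hccd.continuous
  set Y1 : ℝ × ℝ → ℝ := fun x => ((a x).im * (c x).re + (u x).im * (d x).re)
    - ((a x).re * (c x).im + (u x).re * (d x).im)
    + (1 / 2 * ((u x).re * (u x).re + (u x).im * (u x).im)
    + x.1 / 2 * (((a x).re * (u x).re + (u x).re * (a x).re)
      + ((a x).im * (u x).im + (u x).im * (a x).im))) with hY1
  set Y2 : ℝ × ℝ → ℝ := fun x => -(((c x).im * (a x).re + (u x).im * (d x).re)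
    - ((c x).re * (a x).im + (u x).re * (d x).im))
    + (1 / 2 * ((u x).re * (u x).re + (u x).im * (u x).im)
    + x.2 / 2 * (((c x).re * (u x).re + (u x).re * (c x).re)
      + ((c x).im * (u x).im + (u x).im * (c x).im))) with hY2
  have zu : ∀ x ∉ tsupport u, u x = 0 := fun x hx => image_eq_zero_of_notMem_tsupport hx
  have za : ∀ x ∉ tsupport u, a x = 0 := fun x hx => by
    simp [ha, fderiv_eq_zero_of_notMem_tsupport hx]
  have zc : ∀ x ∉ tsupport u, c x = 0 := fun x hx => by
    simp [hcc, fderiv_eq_zero_of_notMem_tsupport hx]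
  have iY1 : ∫ x, Y1 x = 0 := by
    refine integral_lineDeriv_eq_zero (X := X1) (v := (1, 0)) hc (by fun_prop) (by fun_prop)
      (fun x hx => by simp [hX1, zu x hx]) (fun x hx => by simp [hY1, zu x hx, za x hx])
      (fun x => ?_)
    have e0 : x + ((0 : ℝ), (0 : ℝ)) = x := add_zero x
    obtain ⟨ur, ui⟩ := hasDerivAt_line_re_im hu x (1, 0)
    obtain ⟨cr, ci⟩ := hasDerivAt_line_re_im hccd x (1, 0)
    have h1 : HasDerivAt (fun t : ℝ => (x + t • ((1 : ℝ), (0 : ℝ))).1 / 2) (1 / 2) 0 := by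
      simpa using ((hasDerivAt_id (0 : ℝ)).const_add x.1).div_const 2
    have := ((ui.mul cr).sub (ur.mul ci)).add (h1.mul ((ur.mul ur).add (ui.mul ui)))
    exact this.congr_deriv (by simp [hY1, ha, hcc, hd, e0])
  have iY2 : ∫ x, Y2 x = 0 := by
    refine integral_lineDeriv_eq_zero (X := X2) (v := (0, 1)) hc (by fun_prop) (by fun_prop)
      (fun x hx => by simp [hX2, zu x hx]) (fun x hx => by simp [hY2, zu x hx, zc x hx])
      (fun x => ?_)
    have e0 : x + ((0 : ℝ), (0 : ℝ)) = x := add_zero x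
    obtain ⟨ur, ui⟩ := hasDerivAt_line_re_im hu x (0, 1)
    obtain ⟨ar, ai⟩ := hasDerivAt_line_re_im hac x (0, 1)
    rw [hda] at ar ai
    have h1 : HasDerivAt (fun t : ℝ => (x + t • ((0 : ℝ), (1 : ℝ))).2 / 2) (1 / 2) 0 := by
      simpa using ((hasDerivAt_id (0 : ℝ)).const_add x.2).div_const 2
    have := ((ui.mul ar).sub (ur.mul ai)).neg.add (h1.mul ((ur.mul ur).add (ui.mul ui)))
    exact this.congr_deriv (by simp [hY2, ha, hcc, hd, e0])
  have e : ∀ x, ‖D1 u x‖ ^ 2 + ‖D2 u x‖ ^ 2 - ‖dbarA u x‖ ^ 2 - ‖u x‖ ^ 2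
      = -(Y1 x + Y2 x) := by
    intro x
    simp only [D1, D2, dbarA, A0, hY1, hY2, ← Complex.normSq_eq_norm_sq, Complex.normSq_apply]
    rw [show fderiv ℝ u x (1, 0) = a x from rfl, show fderiv ℝ u x (0, 1) = c x from rfl]
    simp
    ring
  have j1 : Integrable Y1 := integrable_of_vanish hc (by fun_prop)
    (fun x hx => by simp [hY1, zu x hx, za x hx])
  have j2 : Integrable Y2 := integrable_of_vanish hc (by fun_prop)
    (fun x hx => by simp [hY2, zu x hx, zc x hx])
  simp_rw [e]
  rw [integral_neg, integral_add j1 j2, iY1, iY2]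
  simp

end TestFunctions

/-- The energy density after integration by parts. -/
noncomputable def energyDensity (b : ℝ) (u : ℝ × ℝ → ℂ) (x : ℝ × ℝ) : ℝ :=
  b * ‖dbarA u x‖ ^ 2 + (b - 1) * ‖u x‖ ^ 2 + (1/2) * ‖u x‖ ^ 4

/-- The energy on the whole plane after integration by parts. -/
noncomputable def planeEnergy (b : ℝ) (u : ℝ × ℝ → ℂ) : ℝ := ∫ x, energyDensity b u x

theorem energyDensity_eq_zero {b : ℝ} {u : ℝ × ℝ → ℂ} {x : ℝ × ℝ} (hx : x ∉ tsupport u) :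
    energyDensity b u x = 0 := by
  simp [energyDensity, dbarA_eq_zero_of_notMem_tsupport hx, image_eq_zero_of_notMem_tsupport hx]

theorem continuous_energyDensity {b : ℝ} {u : ℝ × ℝ → ℂ} (hu : ContDiff ℝ (⊤ : ℕ∞) u) :
    Continuous (energyDensity b u) := by
  have h1 := continuous_dbarA hu
  have h2 := hu.continuous
  unfold energyDensity
  fun_prop

theorem TestOn.integrable_energyDensity {b : ℝ} {u : ℝ × ℝ → ℂ} {U : Set (ℝ × ℝ)}
    (hu : TestOn U u) : Integrable (energyDensity b u) :=
  integrable_of_vanish hu.compact (continuous_energyDensity hu.smooth)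
    fun _ hx => energyDensity_eq_zero hx

theorem TestOn.G2_eq {b R : ℝ} {u : ℝ × ℝ → ℂ} (hu : TestOn (KR R) u) :
    G2 b R u = planeEnergy b u := by
  unfold G2 planeEnergy
  have zero : ∀ x ∉ tsupport u, u x = 0 ∧ D1 u x = 0 ∧ D2 u x = 0 ∧ dbarA u x = 0 :=
    fun x hx => by
      have h := fderiv_eq_zero_of_notMem_tsupport hx
      have h' := image_eq_zero_of_notMem_tsupport hx
      simp [D1, D2, dbarA, h, h']
  have c0 := hu.smooth.continuous
  have c1 := continuous_fderiv_apply_const hu.smooth (1, 0)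
  have c2 := continuous_fderiv_apply_const hu.smooth (0, 1)
  have c3 := continuous_dbarA hu.smooth
  have cD1 : Continuous (D1 u) := by unfold D1 A0; fun_prop
  have cD2 : Continuous (D2 u) := by unfold D2 A0; fun_prop
  rw [setIntegral_eq_integral_of_forall_compl_eq_zero]
  · have hi : Integrable fun x =>
        ‖D1 u x‖ ^ 2 + ‖D2 u x‖ ^ 2 - ‖dbarA u x‖ ^ 2 - ‖u x‖ ^ 2 :=
      integrable_of_vanish hu.compact (by fun_prop) fun x hx => by simp [zero x hx]
    have := integral_kinetic_sub hu.smooth hu.compact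
    rw [← add_zero (∫ x, energyDensity b u x), ← mul_zero b, ← this,
      ← integral_const_mul, ← integral_add hu.integrable_energyDensity (hi.const_mul b)]
    refine integral_congr_ae (Eventually.of_forall fun x => ?_)
    simp only [energyDensity]
    ring
  · intro x hx
    have := zero x (fun h => hx (hu.supp h))
    simp [this]

theorem TestOn.mono {U V : Set (ℝ × ℝ)} {u : ℝ × ℝ → ℂ} (hu : TestOn U u) (h : U ⊆ V) :
    TestOn V u :=
  ⟨hu.smooth, hu.compact, hu.supp.trans h⟩

theorem testOn_zero (U : Set (ℝ × ℝ)) : TestOn U fun _ => 0 :=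
  ⟨contDiff_const, HasCompactSupport.zero, by
    simp [show tsupport (fun _ : ℝ × ℝ => (0 : ℂ)) = ∅ from tsupport_eq_empty_iff.2 rfl]⟩

theorem TestOn.add {U : Set (ℝ × ℝ)} {u w : ℝ × ℝ → ℂ} (hu : TestOn U u) (hw : TestOn U w) :
    TestOn U fun x => u x + w x :=
  ⟨hu.smooth.add hw.smooth, hu.compact.add hw.compact,
    (tsupport_add u w).trans (union_subset hu.supp hw.supp)⟩

theorem TestOn.const_mul {U : Set (ℝ × ℝ)} {u : ℝ × ℝ → ℂ} (hu : TestOn U u) (c : ℂ) :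
    TestOn U fun x => c * u x :=
  ⟨contDiff_const.mul hu.smooth, hu.compact.mul_left,
    (tsupport_mul_subset_right (f := fun _ => c)).trans hu.supp⟩

theorem dbarA_add {u w : ℝ × ℝ → ℂ} (hu : ContDiff ℝ (⊤ : ℕ∞) u) (hw : ContDiff ℝ (⊤ : ℕ∞) w)
    (x : ℝ × ℝ) : dbarA (fun x => u x + w x) x = dbarA u x + dbarA w x := by
  have h : fderiv ℝ (fun x => u x + w x) x = fderiv ℝ u x + fderiv ℝ w x :=
    fderiv_add (hu.differentiable (by simp) x) (hw.differentiable (by simp) x)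
  simp only [dbarA, h, _root_.add_apply]
  ring

theorem dbarA_const_mul {u : ℝ × ℝ → ℂ} (hu : ContDiff ℝ (⊤ : ℕ∞) u) (c : ℂ)
    (x : ℝ × ℝ) : dbarA (fun x => c * u x) x = c * dbarA u x := by
  have h : fderiv ℝ (fun x => c * u x) x = c • fderiv ℝ u x :=
    fderiv_const_mul (hu.differentiable (by simp) x) c
  simp only [dbarA, h, _root_.smul_apply, smul_eq_mul]
  ring

theorem TestOn.planeEnergy_ge {b R : ℝ} {u : ℝ × ℝ → ℂ} (hb : 0 ≤ b) (hR : 0 ≤ R)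
    (hu : TestOn (KR R) u) : -(1/2) * (b - 1) ^ 2 * R ^ 2 ≤ planeEnergy b u := by
  have hvol : volume.real (KR R) = R ^ 2 := by
    rw [KR, Measure.volume_eq_prod, measureReal_prod_prod, Real.volume_real_Ioo_of_le (by linarith)]
    ring
  have hfin : volume (KR R) ≠ ⊤ := by
    rw [KR, Measure.volume_eq_prod, Measure.prod_prod, Real.volume_Ioo]
    exact ENNReal.mul_ne_top ENNReal.ofReal_ne_top ENNReal.ofReal_ne_top
  have e : planeEnergy b u = ∫ x in KR R, energyDensity b u x :=
    (setIntegral_eq_integral_of_forall_compl_eq_zero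
      fun x hx => energyDensity_eq_zero fun h => hx (hu.supp h)).symm
  have hc : ∫ _ in KR R, (-(1/2) * (b - 1) ^ 2 : ℝ) = -(1/2) * (b - 1) ^ 2 * R ^ 2 := by
    rw [setIntegral_const, hvol, smul_eq_mul]
    ring
  rw [e, ← hc]
  refine integral_mono (integrableOn_const hfin) hu.integrable_energyDensity.integrableOn
    fun x => ?_
  simp only [energyDensity]
  nlinarith [mul_nonneg hb (sq_nonneg ‖dbarA u x‖), sq_nonneg (‖u x‖ ^ 2 + (b - 1))]

theorem m0_eq (b R : ℝ) :
    m0 b R = sInf (planeEnergy b '' {u | TestOn (KR R) u}) := by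
  unfold m0
  congr 1
  ext E
  constructor
  · rintro ⟨u, h1, h2, h3, rfl⟩
    exact ⟨u, ⟨h1, h2, h3⟩, (TestOn.G2_eq ⟨h1, h2, h3⟩).symm⟩
  · rintro ⟨u, hu, rfl⟩
    exact ⟨u, hu.smooth, hu.compact, hu.supp, (TestOn.G2_eq hu).symm⟩

theorem TestOn.m0_le {b R : ℝ} {u : ℝ × ℝ → ℂ} (hb : 0 ≤ b) (hR : 0 ≤ R)
    (hu : TestOn (KR R) u) : m0 b R ≤ planeEnergy b u := by
  rw [m0_eq]
  refine csInf_le ⟨-(1/2) * (b - 1) ^ 2 * R ^ 2, ?_⟩ ⟨u, hu, rfl⟩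
  rintro _ ⟨v, hv, rfl⟩
  exact TestOn.planeEnergy_ge hb hR hv

theorem le_m0 {b R c : ℝ} (h : ∀ u, TestOn (KR R) u → c ≤ planeEnergy b u) : c ≤ m0 b R := by
  rw [m0_eq]
  refine le_csInf ⟨_, _, testOn_zero _, rfl⟩ ?_
  rintro _ ⟨v, hv, rfl⟩
  exact h v hv

theorem m0_nonpos {b R : ℝ} (hb : 0 ≤ b) (hR : 0 ≤ R) : m0 b R ≤ 0 := by
  refine (TestOn.m0_le hb hR (testOn_zero _)).trans (le_of_eq ?_)
  simp [planeEnergy, energyDensity, dbarA]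

theorem KR_mono {r R : ℝ} (h : r ≤ R) : KR r ⊆ KR R :=
  prod_mono (Ioo_subset_Ioo (by linarith) (by linarith)) (Ioo_subset_Ioo (by linarith) (by linarith))

theorem m0_anti {b r R : ℝ} (hb : 0 ≤ b) (hR : 0 ≤ R) (h : r ≤ R) : m0 b R ≤ m0 b r :=
  le_m0 fun _ hu => (hu.mono (KR_mono h)).m0_le hb hR

/-- The magnetic translation of `u` by `γ`. -/
noncomputable def magTranslate (γ : ℝ × ℝ) (u : ℝ × ℝ → ℂ) (x : ℝ × ℝ) : ℂ :=
  Complex.exp (((γ.1 * x.2 - γ.2 * x.1) / 2 : ℝ) * Complex.I) * u (x - γ)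

theorem norm_magTranslate (γ : ℝ × ℝ) (u : ℝ × ℝ → ℂ) (x : ℝ × ℝ) :
    ‖magTranslate γ u x‖ = ‖u (x - γ)‖ := by
  rw [magTranslate, norm_mul, Complex.norm_exp_ofReal_mul_I, one_mul]

theorem norm_dbarA_magTranslate {u : ℝ × ℝ → ℂ} (hu : ContDiff ℝ (⊤ : ℕ∞) u) (γ x : ℝ × ℝ) :
    ‖dbarA (magTranslate γ u) x‖ = ‖dbarA u (x - γ)‖ := by
  have hd : HasFDerivAt u (fderiv ℝ u (x - γ)) (x - γ) :=
    (hu.differentiable (by simp) _).hasFDerivAt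
  set z := Complex.exp (((γ.1 * x.2 - γ.2 * x.1) / 2 : ℝ) * Complex.I) with hz
  have key : ∀ v : ℝ × ℝ, fderiv ℝ (magTranslate γ u) x v = z * fderiv ℝ u (x - γ) v
      + z * (((γ.1 * v.2 - γ.2 * v.1) / 2 : ℝ) * Complex.I) * u (x - γ) := by
    intro v
    have hdiff : DifferentiableAt ℝ (magTranslate γ u) x := by
      have h1 : DifferentiableAt ℝ (fun x : ℝ × ℝ => u (x - γ)) x :=
        hd.differentiableAt.comp x (by fun_prop)
      have h2 : DifferentiableAt ℝ (fun x : ℝ × ℝ =>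
          Complex.exp (((γ.1 * x.2 - γ.2 * x.1) / 2 : ℝ) * Complex.I)) x := by
        refine DifferentiableAt.cexp (DifferentiableAt.mul_const ?_ _)
        have h3 : DifferentiableAt ℝ (fun x : ℝ × ℝ => (γ.1 * x.2 - γ.2 * x.1) / 2) x := by
          fun_prop
        exact Complex.ofRealCLM.differentiableAt.comp x h3
      exact h2.mul h1
    have hl := (hdiff.hasFDerivAt.hasLineDerivAt v).lineDeriv
    have hu' : HasDerivAt (fun t : ℝ => u (x + t • v - γ)) (fderiv ℝ u (x - γ) v) 0 := by
      have := hd.hasLineDerivAt v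
      simpa [HasLineDerivAt, sub_add_eq_add_sub] using this
    have he : HasDerivAt (fun t : ℝ => (((γ.1 * (x + t • v).2 - γ.2 * (x + t • v).1) / 2 : ℝ) : ℂ)
        * Complex.I) (((γ.1 * v.2 - γ.2 * v.1) / 2 : ℝ) * Complex.I) 0 := by
      refine HasDerivAt.mul_const (HasDerivAt.ofReal_comp ?_) _
      have h1 : HasDerivAt (fun t : ℝ => (x + t • v).1) v.1 0 := by
        simpa using ((hasDerivAt_id (0 : ℝ)).mul_const v.1).const_add x.1
      have h2 : HasDerivAt (fun t : ℝ => (x + t • v).2) v.2 0 := by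
        simpa using ((hasDerivAt_id (0 : ℝ)).mul_const v.2).const_add x.2
      exact ((h2.const_mul γ.1).sub (h1.const_mul γ.2)).div_const 2
    have h := he.cexp.mul hu'
    have hL : HasLineDerivAt ℝ (magTranslate γ u) _ x v := h
    rw [← hl, hL.lineDeriv]
    simp only [zero_smul, add_zero, ← hz]
    ring
  have : dbarA (magTranslate γ u) x = z * dbarA u (x - γ) := by
    simp only [dbarA, key, magTranslate, ← hz]
    simp
    linear_combination (- z * u (x - γ) * (γ.1 : ℂ) / 2 + z * u (x - γ) * γ.1 / 2
      + z * u (x - γ) * γ.1 / 2) * Complex.I_sq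
  rw [this, norm_mul, hz, Complex.norm_exp_ofReal_mul_I, one_mul]

theorem tsupport_magTranslate (γ : ℝ × ℝ) (u : ℝ × ℝ → ℂ) :
    tsupport (magTranslate γ u) ⊆ {x | x - γ ∈ tsupport u} := by
  refine closure_minimal (fun x hx => subset_tsupport u ?_)
    ((isClosed_tsupport u).preimage (by fun_prop : Continuous fun x : ℝ × ℝ => x - γ))
  exact fun h => hx (by simp [magTranslate, h])

theorem TestOn.magTranslate {U V : Set (ℝ × ℝ)} {u : ℝ × ℝ → ℂ} (hu : TestOn U u) (γ : ℝ × ℝ)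
    (h : ∀ x, x - γ ∈ U → x ∈ V) : TestOn V (magTranslate γ u) := by
  refine ⟨?_, ?_, (tsupport_magTranslate γ u).trans fun x hx => h x (hu.supp hx)⟩
  · have h1 : ContDiff ℝ (⊤ : ℕ∞) (fun x : ℝ × ℝ => u (x - γ)) :=
      hu.smooth.comp (by fun_prop)
    have h2 : ContDiff ℝ (⊤ : ℕ∞) (fun x : ℝ × ℝ =>
        Complex.exp (((γ.1 * x.2 - γ.2 * x.1) / 2 : ℝ) * Complex.I)) := by
      refine ContDiff.cexp (ContDiff.mul ?_ contDiff_const)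
      have h3 : ContDiff ℝ (⊤ : ℕ∞) (fun x : ℝ × ℝ => (γ.1 * x.2 - γ.2 * x.1) / 2) := by
        fun_prop
      exact Complex.ofRealCLM.contDiff.comp h3
    exact h2.mul h1
  · refine (hu.compact.isCompact.image (by fun_prop : Continuous fun x => x + γ)).of_isClosed_subset
      (isClosed_tsupport _) fun x hx => ⟨x - γ, tsupport_magTranslate γ u hx, by simp⟩

theorem planeEnergy_magTranslate {b : ℝ} {u : ℝ × ℝ → ℂ} (hu : ContDiff ℝ (⊤ : ℕ∞) u)
    (γ : ℝ × ℝ) : planeEnergy b (magTranslate γ u) = planeEnergy b u := by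
  rw [planeEnergy, planeEnergy, ← integral_sub_right_eq_self (energyDensity b u) γ]
  simp only [energyDensity, norm_magTranslate, norm_dbarA_magTranslate hu]

theorem planeEnergy_add_of_disjoint {b : ℝ} {U V : Set (ℝ × ℝ)} {u w : ℝ × ℝ → ℂ}
    (hu : TestOn U u) (hw : TestOn V w) (h : Disjoint U V) :
    planeEnergy b (fun x => u x + w x) = planeEnergy b u + planeEnergy b w := by
  rw [planeEnergy, planeEnergy, planeEnergy,
    ← integral_add hu.integrable_energyDensity hw.integrable_energyDensity]
  refine integral_congr_ae (Eventually.of_forall fun x => ?_)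
  by_cases hx : x ∈ tsupport u
  · have hx' : x ∉ tsupport w := fun h' => h.le_bot ⟨hu.supp hx, hw.supp h'⟩
    simp [energyDensity, dbarA_add hu.smooth hw.smooth, dbarA_eq_zero_of_notMem_tsupport hx',
      image_eq_zero_of_notMem_tsupport hx']
  · simp [energyDensity, dbarA_add hu.smooth hw.smooth, dbarA_eq_zero_of_notMem_tsupport hx,
      image_eq_zero_of_notMem_tsupport hx]

/-- Gluing finitely many disjoint magnetic translates. -/
theorem exists_glued {ι : Type*} [DecidableEq ι] {b : ℝ} {U : Set (ℝ × ℝ)} {u : ℝ × ℝ → ℂ}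
    (hu : TestOn U u) (γ : ι → ℝ × ℝ) (s : Finset ι)
    (hd : ∀ i j, ∀ x, x - γ i ∈ U → x - γ j ∈ U → i = j) :
    ∃ v, TestOn {x | ∃ i ∈ s, x - γ i ∈ U} v ∧ planeEnergy b v = s.card * planeEnergy b u := by
  induction s using Finset.induction_on with
  | empty =>
    refine ⟨_, testOn_zero _, ?_⟩
    simp [planeEnergy, energyDensity, dbarA]
  | insert a s ha ih =>
    obtain ⟨v, hv, he⟩ := ih
    have ht : TestOn {x | x - γ a ∈ U} (magTranslate (γ a) u) := hu.magTranslate _ fun _ => id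
    have hdis : Disjoint {x | x - γ a ∈ U} {x | ∃ i ∈ s, x - γ i ∈ U} := by
      rw [Set.disjoint_left]
      rintro x hx ⟨i, hi, hx'⟩
      exact ha (hd _ _ x hx hx' ▸ hi)
    refine ⟨_, (ht.mono ?_).add (hv.mono ?_), ?_⟩
    · exact fun x hx => ⟨a, Finset.mem_insert_self _ _, hx⟩
    · rintro x ⟨i, hi, hx⟩
      exact ⟨i, Finset.mem_insert_of_mem hi, hx⟩
    · rw [planeEnergy_add_of_disjoint ht hv hdis, he, planeEnergy_magTranslate hu.smooth,
        Finset.card_insert_of_notMem ha]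
      push_cast
      ring

theorem m0_nat_mul_le {b r : ℝ} (hb : 0 ≤ b) (hr : 0 < r) (n : ℕ) :
    m0 b (n * r) ≤ n ^ 2 * m0 b r := by
  rcases Nat.eq_zero_or_pos n with rfl | hn
  · simpa using m0_nonpos (R := 0) hb le_rfl
  have hn2 : (0 : ℝ) < (n : ℝ) ^ 2 := by positivity
  have hn1 : (1 : ℝ) ≤ n := by exact_mod_cast hn
  rw [← div_le_iff₀' hn2]
  refine le_m0 fun u hu => ?_
  rw [div_le_iff₀' hn2]
  let c : ℕ → ℝ := fun i => (i + 1 / 2) * r - n * r / 2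
  have hinj : ∀ (i j : ℕ) (y : ℝ), y - c i ∈ Ioo (-r/2) (r/2) → y - c j ∈ Ioo (-r/2) (r/2) →
      i = j := by
    rintro i j y ⟨h1, h2⟩ ⟨h3, h4⟩
    simp only [c] at h1 h2 h3 h4
    have h5 : (i : ℝ) < j + 1 := by
      by_contra h
      push Not at h
      nlinarith
    have h6 : (j : ℝ) < i + 1 := by
      by_contra h
      push Not at h
      nlinarith
    have h5' : i < j + 1 := by exact_mod_cast h5
    have h6' : j < i + 1 := by exact_mod_cast h6
    omega
  have hmem : ∀ i < n, ∀ y : ℝ, y - c i ∈ Ioo (-r/2) (r/2) →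
      y ∈ Ioo (-(n * r)/2) (n * r/2) := by
    rintro i hi y ⟨h1, h2⟩
    simp only [c] at h1 h2
    have h3 : (i : ℝ) + 1 ≤ n := by exact_mod_cast hi
    have h4 : (0 : ℝ) ≤ i := by positivity
    constructor <;> nlinarith
  obtain ⟨v, hv, he⟩ := exists_glued (b := b) hu (fun p : ℕ × ℕ => (c p.1, c p.2))
    (Finset.range n ×ˢ Finset.range n) (by
      rintro ⟨i1, i2⟩ ⟨j1, j2⟩ x hi hj
      exact Prod.ext (hinj _ _ _ hi.1 hj.1) (hinj _ _ _ hi.2 hj.2))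
  have hv' : TestOn (KR (n * r)) v := hv.mono (by
    rintro x ⟨⟨i1, i2⟩, hi, hx⟩
    simp only [Finset.mem_product, Finset.mem_range] at hi
    exact ⟨hmem _ hi.1 _ hx.1, hmem _ hi.2 _ hx.2⟩)
  have := hv'.m0_le (b := b) hb (by positivity)
  rw [he] at this
  simpa [pow_two] using this

theorem le_m0_div {b R : ℝ} (hb : 0 ≤ b) (hR : 0 < R) :
    -(1/2) * (b - 1) ^ 2 ≤ m0 b R / R ^ 2 := by
  rw [le_div_iff₀ (by positivity)]
  exact le_m0 fun u hu => hu.planeEnergy_ge hb hR.le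

theorem bddBelow_m0_div {b : ℝ} (hb : 0 ≤ b) :
    BddBelow ((fun R : ℝ => m0 b R / R ^ 2) '' Ioi 0) :=
  ⟨-(1/2) * (b - 1) ^ 2, by rintro _ ⟨R, hR, rfl⟩; exact le_m0_div hb hR⟩

/-- The thermodynamic limit exists and is the infimum of `m₀(b,R)/R²`. -/
theorem tendsto_m0_div {b : ℝ} (hb : 0 ≤ b) :
    Tendsto (fun R : ℝ => m0 b R / R ^ 2) atTop
      (nhds (sInf ((fun R : ℝ => m0 b R / R ^ 2) '' Ioi 0))) := by
  set f := fun R : ℝ => m0 b R / R ^ 2 with hf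
  have hbdd : BddBelow (f '' Ioi 0) := bddBelow_m0_div hb
  refine tendsto_order.2 ⟨fun a ha => ?_, fun a ha => ?_⟩
  · filter_upwards [eventually_gt_atTop 0] with R hR
    exact ha.trans_le (csInf_le hbdd ⟨R, hR, rfl⟩)
  · obtain ⟨_, ⟨r, hr, rfl⟩, hlt⟩ := exists_lt_of_csInf_lt (nonempty_Ioi.image f) ha
    have hr : 0 < r := hr
    have hlim : Tendsto (fun R : ℝ => ((⌊R / r⌋₊ : ℝ) / (R / r)) ^ 2 * f r) atTop
        (nhds (1 ^ 2 * f r)) :=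
      (((tendsto_nat_floor_div_atTop (R := ℝ)).comp (tendsto_id.atTop_div_const hr)).pow 2).mul_const _
    rw [one_pow, one_mul] at hlim
    filter_upwards [hlim.eventually (gt_mem_nhds hlt), eventually_gt_atTop 0] with R h1 hR
    refine lt_of_le_of_lt ?_ h1
    have h2 : (⌊R / r⌋₊ : ℝ) * r ≤ R := by
      have := Nat.floor_le (a := R / r) (by positivity)
      rwa [le_div_iff₀ hr] at this
    have h3 := (m0_anti hb hR.le h2).trans (m0_nat_mul_le hb hr ⌊R / r⌋₊)
    simp only [hf]
    rw [div_le_iff₀ (by positivity)]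
    refine h3.trans (le_of_eq ?_)
    field_simp

theorem gfun_eq {b : ℝ} (hb : 0 ≤ b) :
    gfun b = sInf ((fun R : ℝ => m0 b R / R ^ 2) '' Ioi 0) :=
  (tendsto_m0_div hb).limUnder_eq

theorem gfun_nonpos {b : ℝ} (hb : 0 ≤ b) : gfun b ≤ 0 := by
  rw [gfun_eq hb]
  refine le_of_tendsto (tendsto_m0_div hb) ?_
  filter_upwards [eventually_ge_atTop 0] with R hR
  exact div_nonpos_of_nonpos_of_nonneg (m0_nonpos hb hR) (sq_nonneg R)

theorem gfun_ge {b : ℝ} (hb : 0 ≤ b) : -(1/2) * (b - 1) ^ 2 ≤ gfun b := by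
  rw [gfun_eq hb]
  refine ge_of_tendsto (tendsto_m0_div hb) ?_
  filter_upwards [eventually_gt_atTop 0] with R hR using le_m0_div hb hR

theorem TestOn.gfun_le {b R : ℝ} {u : ℝ × ℝ → ℂ} (hb : 0 ≤ b) (hR : 0 < R)
    (hu : TestOn (KR R) u) : gfun b ≤ planeEnergy b u / R ^ 2 := by
  rw [gfun_eq hb]
  exact (csInf_le (bddBelow_m0_div hb) (mem_image_of_mem _ hR)).trans
    (div_le_div_of_nonneg_right (hu.m0_le hb hR.le) (sq_nonneg R))

theorem norm_add_pow_four_add_norm_sub_pow_four_le (z w : ℂ) :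
    ‖z + w‖ ^ 4 + ‖z - w‖ ^ 4 ≤ 2 * ‖z‖ ^ 4 + 12 * ‖z‖ ^ 2 * ‖w‖ ^ 2 + 2 * ‖w‖ ^ 4 := by
  have h4 : ∀ v : ℂ, ‖v‖ ^ 4 = (‖v‖ ^ 2) ^ 2 := fun v => by ring
  simp only [h4, ← Complex.normSq_eq_norm_sq, Complex.normSq_apply, Complex.add_re, Complex.add_im,
    Complex.sub_re, Complex.sub_im]
  nlinarith [sq_nonneg (z.re * w.im - z.im * w.re)]

theorem norm_add_sq_add_norm_sub_sq (z w : ℂ) :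
    ‖z + w‖ ^ 2 + ‖z - w‖ ^ 2 = 2 * ‖z‖ ^ 2 + 2 * ‖w‖ ^ 2 := by
  simp only [← Complex.normSq_eq_norm_sq, Complex.normSq_apply, Complex.add_re, Complex.add_im,
    Complex.sub_re, Complex.sub_im]
  ring

/-- An upper bound for the average energy density of `u + ∑ ± w i` over all choices of signs. -/
noncomputable def signAverageBound {ι : Type*} (b : ℝ) (w : ι → ℝ × ℝ → ℂ) (s : Finset ι)
    (u : ℝ × ℝ → ℂ) (x : ℝ × ℝ) : ℝ :=
  energyDensity b u x + ∑ i ∈ s, (b * ‖dbarA (w i) x‖ ^ 2 + (b - 1) * ‖w i x‖ ^ 2)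
    + 3 * ‖u x‖ ^ 2 * ∑ i ∈ s, ‖w i x‖ ^ 2 + 3 / 2 * (∑ i ∈ s, ‖w i x‖ ^ 2) ^ 2

theorem integrable_signAverageBound {ι : Type*} {b : ℝ} {U : Set (ℝ × ℝ)} {w : ι → ℝ × ℝ → ℂ}
    (hw : ∀ i, TestOn U (w i)) (s : Finset ι) {u : ℝ × ℝ → ℂ} (hu : TestOn U u) :
    Integrable (signAverageBound b w s u) := by
  have c1 := continuous_energyDensity (b := b) hu.smooth
  have c2 := hu.smooth.continuous
  have c3 := fun i => (hw i).smooth.continuous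
  have c4 := fun i => continuous_dbarA (hw i).smooth
  refine integrable_of_vanish
    (hu.compact.isCompact.union (s.isCompact_biUnion fun i _ => (hw i).compact.isCompact)) ?_ ?_
  · unfold signAverageBound
    fun_prop
  · intro x hx
    simp only [mem_union, mem_iUnion, not_or, not_exists] at hx
    have h1 : ∀ i ∈ s, w i x = 0 := fun i hi => image_eq_zero_of_notMem_tsupport (hx.2 i hi)
    have h2 : ∀ i ∈ s, dbarA (w i) x = 0 := fun i hi => dbarA_eq_zero_of_notMem_tsupport (hx.2 i hi)
    have e1 : ∑ i ∈ s, ‖w i x‖ ^ 2 = 0 := Finset.sum_eq_zero fun i hi => by simp [h1 i hi]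
    have e2 : ∑ i ∈ s, (b * ‖dbarA (w i) x‖ ^ 2 + (b - 1) * ‖w i x‖ ^ 2) = 0 :=
      Finset.sum_eq_zero fun i hi => by simp [h1 i hi, h2 i hi]
    simp [signAverageBound, e1, e2, energyDensity_eq_zero hx.1]

theorem signAverageBound_add_le {ι : Type*} [DecidableEq ι] {b : ℝ} {U : Set (ℝ × ℝ)}
    {w : ι → ℝ × ℝ → ℂ} (hw : ∀ i, TestOn U (w i)) {s : Finset ι} {a : ι} (ha : a ∉ s)
    {u : ℝ × ℝ → ℂ} (hu : TestOn U u) (x : ℝ × ℝ) :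
    signAverageBound b w s (fun x => u x + w a x) x
      + signAverageBound b w s (fun x => u x + (-1) * w a x) x
      ≤ 2 * signAverageBound b w (insert a s) u x := by
  simp only [signAverageBound, energyDensity, Finset.sum_insert ha,
    dbarA_add hu.smooth (hw a).smooth, dbarA_add hu.smooth ((hw a).const_mul (-1)).smooth,
    dbarA_const_mul (hw a).smooth]
  simp only [neg_one_mul, ← sub_eq_add_neg]
  have h1 := norm_add_pow_four_add_norm_sub_pow_four_le (u x) (w a x)
  have h2 := norm_add_sq_add_norm_sub_sq (u x) (w a x)
  have h3 := norm_add_sq_add_norm_sub_sq (dbarA u x) (dbarA (w a) x)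
  have h4 : 0 ≤ ‖w a x‖ ^ 4 := by positivity
  set S := ∑ i ∈ s, ‖w i x‖ ^ 2
  linear_combination 2 * h4 + (1 / 2) * h1 + (b - 1) * h2 + b * h3 + 3 * S * h2

/-- Some choice of signs does at least as well as the average. -/
theorem exists_le_integral_signAverageBound {ι : Type*} [DecidableEq ι] {b : ℝ} {U : Set (ℝ × ℝ)}
    {w : ι → ℝ × ℝ → ℂ} (hw : ∀ i, TestOn U (w i)) (s : Finset ι) :
    ∀ u, TestOn U u →
      ∃ v, TestOn U v ∧ planeEnergy b v ≤ ∫ x, signAverageBound b w s u x := by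
  induction s using Finset.induction_on with
  | empty => exact fun u hu => ⟨u, hu, by simp [signAverageBound, planeEnergy]⟩
  | insert a s ha ih =>
    intro u hu
    have hp := hu.add (hw a)
    have hm := hu.add ((hw a).const_mul (-1))
    obtain ⟨v, hv, hv'⟩ := ih _ hp
    obtain ⟨v', hv₂, hv₂'⟩ := ih _ hm
    have ip := integrable_signAverageBound (b := b) hw s hp
    have im := integrable_signAverageBound (b := b) hw s hm
    have key := integral_mono (ip.add im)
      ((integrable_signAverageBound (b := b) hw (insert a s) hu).const_mul 2)
      (fun x => signAverageBound_add_le hw ha hu x)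
    have ea := integral_add ip im
    simp only [Pi.add_apply] at key
    rw [ea, integral_const_mul] at key
    by_cases h : planeEnergy b v ≤ ∫ x, signAverageBound b w (insert a s) u x
    · exact ⟨v, hv, h⟩
    · refine ⟨v', hv₂, ?_⟩
      push Not at h
      linarith

theorem exists_sum_exp_neg_sq_le :
    ∃ C : ℝ, 0 < C ∧ ∀ (s : Finset ℤ) (y : ℝ),
      ∑ k ∈ s, Real.exp (-(y - k) ^ 2 / 2) ≤ C := by
  have hs : Summable fun j : ℤ => Real.exp (3 / 2 - |(j : ℝ)|) := by
    have h : Summable fun n : ℕ => Real.exp (3 / 2 - (n : ℝ)) := by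
      simpa [sub_eq_add_neg, Real.exp_add] using Real.summable_exp_neg_nat.mul_left (Real.exp (3 / 2))
    refine Summable.of_nat_of_neg ?_ ?_ <;> simpa using h
  refine ⟨∑' j : ℤ, Real.exp (3 / 2 - |(j : ℝ)|),
    hs.tsum_pos (fun _ => (Real.exp_pos _).le) 0 (Real.exp_pos _), fun s y => ?_⟩
  calc ∑ k ∈ s, Real.exp (-(y - k) ^ 2 / 2)
      ≤ ∑ k ∈ s, Real.exp (3 / 2 - |((k - ⌊y⌋ : ℤ) : ℝ)|) := by
        refine Finset.sum_le_sum fun k _ => Real.exp_le_exp.2 ?_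
        have h1 := Int.floor_le y
        have h2 := Int.lt_floor_add_one y
        have h3 : |((k - ⌊y⌋ : ℤ) : ℝ)| ≤ |y - k| + 1 := by
          push_cast
          rw [abs_le]
          constructor <;> cases abs_cases (y - k) <;> linarith
        nlinarith [sq_nonneg (|y - k| - 1), sq_abs (y - k)]
    _ = ∑ j ∈ s.map (Equiv.subRight ⌊y⌋).toEmbedding, Real.exp (3 / 2 - |(j : ℝ)|) := by
        rw [Finset.sum_map]
        rfl
    _ ≤ _ := hs.sum_le_tsum _ fun _ _ => (Real.exp_pos _).le

theorem integrable_gaussian_prod :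
    Integrable fun x : ℝ × ℝ => Real.exp (-(x.1 ^ 2 + x.2 ^ 2) / 2) := by
  have h := integrable_exp_neg_mul_sq (b := 1 / 2) (by norm_num)
  refine (h.mul_prod h).congr (Eventually.of_forall fun x => ?_)
  simp only [← Real.exp_add]
  ring_nf

/-- The lowest Landau level Gaussian, cut off at scale `S`. -/
noncomputable def cutGauss (φ : ℝ × ℝ → ℝ) (S : ℝ) (x : ℝ × ℝ) : ℂ :=
  ((φ (S⁻¹ • x) * Real.exp (-(x.1 ^ 2 + x.2 ^ 2) / 4) : ℝ) : ℂ)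

theorem contDiff_cutGauss {φ : ℝ × ℝ → ℝ} (hφ : ContDiff ℝ (⊤ : ℕ∞) φ) (S : ℝ) :
    ContDiff ℝ (⊤ : ℕ∞) (cutGauss φ S) := by
  have h1 : ContDiff ℝ (⊤ : ℕ∞) fun x : ℝ × ℝ => φ (S⁻¹ • x) := hφ.comp (by fun_prop)
  have h2 : ContDiff ℝ (⊤ : ℕ∞) fun x : ℝ × ℝ => Real.exp (-(x.1 ^ 2 + x.2 ^ 2) / 4) := by
    fun_prop
  exact Complex.ofRealCLM.contDiff.comp (h1.mul h2)

theorem norm_dbarA_cutGauss_sq {φ : ℝ × ℝ → ℝ} (hφ : ContDiff ℝ (⊤ : ℕ∞) φ) (S : ℝ) (x : ℝ × ℝ) :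
    ‖dbarA (cutGauss φ S) x‖ ^ 2 = S⁻¹ ^ 2 * ((fderiv ℝ φ (S⁻¹ • x) (1, 0)) ^ 2
      + (fderiv ℝ φ (S⁻¹ • x) (0, 1)) ^ 2) * Real.exp (-(x.1 ^ 2 + x.2 ^ 2) / 2) := by
  have hexp : Real.exp (-(x.1 ^ 2 + x.2 ^ 2) / 2) = Real.exp (-(x.1 ^ 2 + x.2 ^ 2) / 4) ^ 2 := by
    rw [← Real.exp_nat_mul]
    ring_nf
  set e := Real.exp (-(x.1 ^ 2 + x.2 ^ 2) / 4) with he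
  have key : ∀ v : ℝ × ℝ, fderiv ℝ (cutGauss φ S) x v =
      ((S⁻¹ * fderiv ℝ φ (S⁻¹ • x) v * e
        + φ (S⁻¹ • x) * (e * (-(x.1 * v.1 + x.2 * v.2) / 2)) : ℝ) : ℂ) := by
    intro v
    have hl := (((contDiff_cutGauss hφ S).differentiable (by simp) x).hasFDerivAt.hasLineDerivAt
      v).lineDeriv
    have h1 : HasDerivAt (fun t : ℝ => φ (S⁻¹ • (x + t • v))) (S⁻¹ * fderiv ℝ φ (S⁻¹ • x) v) 0 := by
      have := (hφ.differentiable (by simp) (S⁻¹ • x)).hasFDerivAt.hasLineDerivAt (S⁻¹ • v)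
      unfold HasLineDerivAt at this
      rw [map_smul, smul_eq_mul] at this
      refine this.congr_of_eventuallyEq (Eventually.of_forall fun t => ?_)
      simp only [smul_add, smul_comm t S⁻¹ v]
    have h2 : HasDerivAt (fun t : ℝ => (x + t • v).1) v.1 0 := by
      simpa using ((hasDerivAt_id (0 : ℝ)).mul_const v.1).const_add x.1
    have h3 : HasDerivAt (fun t : ℝ => (x + t • v).2) v.2 0 := by
      simpa using ((hasDerivAt_id (0 : ℝ)).mul_const v.2).const_add x.2
    have h4 := ((((h2.pow 2).add (h3.pow 2)).neg).div_const 4).exp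
    have h := (h1.mul h4).ofReal_comp
    have hL : HasLineDerivAt ℝ (cutGauss φ S) _ x v := h
    rw [← hl, hL.lineDeriv]
    congr 1
    simp [he]
    left
    ring
  have : dbarA (cutGauss φ S) x = ((S⁻¹ * fderiv ℝ φ (S⁻¹ • x) (1, 0) * e : ℝ) : ℂ)
      + ((S⁻¹ * fderiv ℝ φ (S⁻¹ • x) (0, 1) * e : ℝ) : ℂ) * Complex.I := by
    simp only [dbarA, key, cutGauss, ← he]
    push_cast
    ring
  rw [this, ← Complex.normSq_eq_norm_sq, Complex.normSq_add_mul_I, hexp]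
  ring

/-- Compactly supported almost-minimizers of the kinetic energy under a Gaussian envelope. -/
theorem exists_localized :
    ∃ c > (0 : ℝ), ∀ ε > (0 : ℝ), ∃ (n : ℕ) (w : ℝ × ℝ → ℂ), TestOn (KR (2 * n + 1)) w ∧
      (∀ x, ‖w x‖ ^ 2 ≤ Real.exp (-(x.1 ^ 2 + x.2 ^ 2) / 2)) ∧
      c ≤ ∫ x, ‖w x‖ ^ 2 ∧ ∫ x, ‖dbarA w x‖ ^ 2 ≤ ε := by
  let f : ContDiffBump (0 : ℝ × ℝ) := ⟨1 / 2, 1, by norm_num, by norm_num⟩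
  set φ : ℝ × ℝ → ℝ := fun x => f x
  have hφ : ContDiff ℝ (⊤ : ℕ∞) φ := f.contDiff
  set G : ℝ × ℝ → ℝ := fun x => Real.exp (-(x.1 ^ 2 + x.2 ^ 2) / 2) with hG
  have hGi : Integrable G := integrable_gaussian_prod
  have hGpos : ∀ x, 0 < G x := fun x => Real.exp_pos _
  set B := Metric.closedBall (0 : ℝ × ℝ) (1 / 2) with hB
  have hBpos : 0 < ∫ x in B, G x := by
    rw [setIntegral_pos_iff_support_of_nonneg_ae
      (Eventually.of_forall fun x => (hGpos x).le) hGi.integrableOn]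
    have : Function.support G = univ := by
      ext x
      simp [(hGpos x).ne']
    rw [this, univ_inter]
    exact Metric.measure_closedBall_pos _ _ (by norm_num)
  obtain ⟨M, hM⟩ : ∃ M, ∀ y, ‖(fderiv ℝ φ y (1, 0)) ^ 2 + (fderiv ℝ φ y (0, 1)) ^ 2‖ ≤ M := by
    have hcont : Continuous fun y => (fderiv ℝ φ y (1, 0)) ^ 2 + (fderiv ℝ φ y (0, 1)) ^ 2 := by
      have h1 : ∀ v : ℝ × ℝ, Continuous fun y => fderiv ℝ φ y v := fun v =>
        (hφ.continuous_fderiv (by simp)).clm_apply continuous_const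
      exact ((h1 _).pow 2).add ((h1 _).pow 2)
    refine HasCompactSupport.exists_bound_of_continuous ?_ hcont
    have hs := f.hasCompactSupport
    refine HasCompactSupport.intro hs fun x hx => ?_
    have : fderiv ℝ φ x = 0 := by
      by_contra h
      exact hx (support_fderiv_subset ℝ h)
    simp [this]
  have hM0 : 0 ≤ M := (norm_nonneg _).trans (hM 0)
  refine ⟨_, hBpos, fun ε hε => ?_⟩
  have hI : 0 ≤ ∫ x, G x := integral_nonneg fun x => (hGpos x).le
  obtain ⟨n, hn⟩ := exists_nat_gt (max 1 (M * (∫ x, G x) / ε))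
  have hn1 : (1 : ℝ) < n := (le_max_left _ _).trans_lt hn
  have hn2 : M * (∫ x, G x) / ε < n := (le_max_right _ _).trans_lt hn
  have hn0 : (0 : ℝ) < n := by linarith
  have hball : ∀ x, x ∉ Metric.closedBall (0 : ℝ × ℝ) n → φ ((n : ℝ)⁻¹ • x) = 0 := by
    intro x hx
    rw [mem_closedBall_zero_iff, not_le] at hx
    refine f.zero_of_le_dist ?_
    change (1 : ℝ) ≤ _
    rw [dist_zero_right, norm_smul, norm_inv, RCLike.norm_natCast, inv_mul_eq_div, le_div_iff₀ hn0]
    linarith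
  have hsub : tsupport (cutGauss φ n) ⊆ Metric.closedBall (0 : ℝ × ℝ) n := by
    refine closure_minimal (fun x hx => ?_) Metric.isClosed_closedBall
    by_contra h
    exact hx (by simp [cutGauss, hball x h])
  have hnorm : ∀ x, ‖cutGauss φ n x‖ ^ 2 = φ ((n : ℝ)⁻¹ • x) ^ 2 * G x := by
    intro x
    rw [cutGauss, Complex.norm_real, Real.norm_eq_abs, sq_abs, mul_pow, ← Real.exp_nat_mul]
    simp only [hG]
    ring_nf
  have htest : TestOn (KR (2 * n + 1)) (cutGauss φ n) := by
    refine ⟨contDiff_cutGauss hφ n, (isCompact_closedBall _ _).of_isClosed_subset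
      (isClosed_tsupport _) hsub, fun x hx => ?_⟩
    have := mem_closedBall_zero_iff.1 (hsub hx)
    rw [Prod.norm_def, max_le_iff, Real.norm_eq_abs, Real.norm_eq_abs, abs_le, abs_le] at this
    obtain ⟨⟨h1, h2⟩, h3, h4⟩ := this
    refine ⟨⟨?_, ?_⟩, ?_, ?_⟩ <;> linarith
  have hle : ∀ x, ‖cutGauss φ n x‖ ^ 2 ≤ G x := fun x => by
    rw [hnorm]
    have h1 : φ ((n : ℝ)⁻¹ • x) ≤ 1 := f.le_one
    have h0 : 0 ≤ φ ((n : ℝ)⁻¹ • x) := f.nonneg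
    exact mul_le_of_le_one_left (hGpos x).le (pow_le_one₀ h0 h1)
  refine ⟨n, cutGauss φ n, htest, hle, ?_, ?_⟩
  · have hci : Integrable fun x => ‖cutGauss φ n x‖ ^ 2 :=
      integrable_of_vanish htest.compact (htest.smooth.continuous.norm.pow 2)
        fun x hx => by simp [image_eq_zero_of_notMem_tsupport hx]
    calc ∫ x in B, G x = ∫ x in B, ‖cutGauss φ n x‖ ^ 2 := by
          refine setIntegral_congr_fun Metric.isClosed_closedBall.measurableSet fun x hx => ?_
          have hx' := mem_closedBall_zero_iff.1 hx
          have h1 : φ ((n : ℝ)⁻¹ • x) = 1 := by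
            refine f.one_of_mem_closedBall (mem_closedBall_zero_iff.2 ?_)
            change _ ≤ (1 / 2 : ℝ)
            rw [norm_smul, norm_inv, RCLike.norm_natCast, inv_mul_eq_div, div_le_iff₀ hn0]
            nlinarith [norm_nonneg x]
          simp only [hnorm, h1, one_pow, one_mul]
      _ ≤ _ := setIntegral_le_integral hci (Eventually.of_forall fun x => sq_nonneg _)
  · calc ∫ x, ‖dbarA (cutGauss φ n) x‖ ^ 2 ≤ ∫ x, ((n : ℝ)⁻¹ ^ 2 * M) * G x := by
          refine integral_mono_of_nonneg (Eventually.of_forall fun x => sq_nonneg _)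
            (hGi.const_mul _) (Eventually.of_forall fun x => ?_)
          simp only [norm_dbarA_cutGauss_sq hφ]
          gcongr
          exact (le_abs_self _).trans (hM _)
      _ = (M * ∫ x, G x) / n ^ 2 := by
          rw [integral_const_mul]
          field_simp
      _ ≤ ε := by
          rw [div_lt_iff₀ hε] at hn2
          rw [div_le_iff₀ (by positivity)]
          nlinarith [mul_pos hε hn0]

theorem exists_gfun_le :
    ∃ κ > (0 : ℝ), ∀ b, 0 ≤ b → b ≤ 1 → gfun b ≤ -κ * (b - 1) ^ 2 := by
  obtain ⟨c, hc, hloc⟩ := exists_localized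
  obtain ⟨C, hC, hsum⟩ := exists_sum_exp_neg_sq_le
  set I := ∫ x : ℝ × ℝ, Real.exp (-(x.1 ^ 2 + x.2 ^ 2) / 2) with hI
  have hIpos : 0 < I := by
    obtain ⟨n, w, hw, hwG, hcw, -⟩ := hloc 1 one_pos
    exact hc.trans_le (hcw.trans (integral_mono_of_nonneg
      (Eventually.of_forall fun x => sq_nonneg _) integrable_gaussian_prod
      (Eventually.of_forall hwG)))
  set τ := c / (6 * C ^ 2 * I) with hτ
  have hτpos : 0 < τ := by positivity
  refine ⟨τ * c / 16, by positivity, fun b hb hb1 => ?_⟩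
  rcases hb1.eq_or_lt with rfl | hb1
  · simpa using gfun_nonpos zero_le_one
  have hδ : 0 < 1 - b := by linarith
  obtain ⟨n, w, hw, hwG, hcw, hdw⟩ := hloc ((1 - b) * c / 2) (by positivity)
  set t := √((1 - b) * τ) with ht
  have ht2 : t ^ 2 = (1 - b) * τ := Real.sq_sqrt (by positivity)
  have hwt := hw.const_mul (t : ℂ)
  set J : Finset ℤ := Finset.Icc (-n : ℤ) n with hJ
  have hJcard : (J.card : ℝ) = 2 * n + 1 := by
    have : J.card = 2 * n + 1 := by
      rw [hJ, Int.card_Icc]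
      omega
    rw [this]
    push_cast
    ring
  let γ : J × J → ℝ × ℝ := fun p => ((p.1 : ℤ), (p.2 : ℤ))
  let W : J × J → ℝ × ℝ → ℂ := fun p => magTranslate (γ p) fun x => t * w x
  have hR : (0 : ℝ) < 2 * (2 * n + 1) := by positivity
  have hW : ∀ p, TestOn (KR (2 * (2 * n + 1))) (W p) := by
    rintro ⟨⟨i, hi⟩, j, hj⟩
    refine hwt.magTranslate _ fun x hx => ?_
    obtain ⟨⟨h1, h2⟩, h3, h4⟩ := hx
    simp only [hJ, Finset.mem_Icc] at hi hj
    have hi1 : (-n : ℝ) ≤ i := by exact_mod_cast hi.1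
    have hi2 : (i : ℝ) ≤ n := by exact_mod_cast hi.2
    have hj1 : (-n : ℝ) ≤ j := by exact_mod_cast hj.1
    have hj2 : (j : ℝ) ≤ n := by exact_mod_cast hj.2
    simp only [γ, Prod.fst_sub, Prod.snd_sub] at h1 h2 h3 h4
    refine ⟨⟨?_, ?_⟩, ?_, ?_⟩ <;> linarith
  obtain ⟨v, hv, hvE⟩ := exists_le_integral_signAverageBound (b := b) hW Finset.univ
    _ (testOn_zero _)
  set h : ℝ × ℝ → ℝ := fun x => t ^ 2 * (b * ‖dbarA w x‖ ^ 2
    + (b - 1 + 3 / 2 * t ^ 2 * C ^ 2) * ‖w x‖ ^ 2) with hh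
  have hsumG : ∀ x : ℝ × ℝ, ∑ p : J × J, ‖w (x - γ p)‖ ^ 2 ≤ C ^ 2 := by
    intro x
    calc ∑ p : J × J, ‖w (x - γ p)‖ ^ 2
        ≤ ∑ p : J × J, Real.exp (-(x.1 - (p.1 : ℤ)) ^ 2 / 2)
            * Real.exp (-(x.2 - (p.2 : ℤ)) ^ 2 / 2) := by
          refine Finset.sum_le_sum fun p _ => (hwG _).trans (le_of_eq ?_)
          rw [← Real.exp_add]
          congr 1
          simp only [γ, Prod.fst_sub, Prod.snd_sub]
          ring
      _ = (∑ i : J, Real.exp (-(x.1 - (i : ℤ)) ^ 2 / 2))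
            * ∑ j : J, Real.exp (-(x.2 - (j : ℤ)) ^ 2 / 2) := by
          rw [Finset.sum_mul_sum, ← Finset.univ_product_univ, Finset.sum_product]
      _ = (∑ i ∈ J, Real.exp (-(x.1 - i) ^ 2 / 2)) * ∑ j ∈ J, Real.exp (-(x.2 - j) ^ 2 / 2) := by
          rw [← Finset.sum_coe_sort J fun i : ℤ => Real.exp (-(x.1 - i) ^ 2 / 2),
            ← Finset.sum_coe_sort J fun i : ℤ => Real.exp (-(x.2 - i) ^ 2 / 2)]
      _ ≤ C ^ 2 := by
          rw [pow_two]
          exact mul_le_mul (hsum J _) (hsum J _) (Finset.sum_nonneg fun _ _ => (Real.exp_pos _).le)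
            hC.le
  have hptw : ∀ x, signAverageBound b W Finset.univ (fun _ => 0) x ≤ ∑ p, h (x - γ p) := by
    intro x
    have e1 : ∀ p, ‖W p x‖ ^ 2 = t ^ 2 * ‖w (x - γ p)‖ ^ 2 := fun p => by
      simp only [W, norm_magTranslate, norm_mul, Complex.norm_real, mul_pow, Real.norm_eq_abs,
        sq_abs]
    have e2 : ∀ p, ‖dbarA (W p) x‖ ^ 2 = t ^ 2 * ‖dbarA w (x - γ p)‖ ^ 2 := fun p => by
      simp only [W, norm_dbarA_magTranslate hwt.smooth, dbarA_const_mul hw.smooth, norm_mul,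
        Complex.norm_real, mul_pow, Real.norm_eq_abs, sq_abs]
    have e3 : energyDensity b (fun _ => 0) x = 0 := by simp [energyDensity, dbarA]
    have e4 : ∑ p, h (x - γ p) = ∑ p, (b * ‖dbarA (W p) x‖ ^ 2 + (b - 1) * ‖W p x‖ ^ 2)
        + 3 / 2 * (t ^ 2 * C ^ 2) * ∑ p, ‖W p x‖ ^ 2 := by
      rw [Finset.mul_sum, ← Finset.sum_add_distrib]
      refine Finset.sum_congr rfl fun p _ => ?_
      rw [e1, e2]
      simp only [hh]
      ring
    have e5 : ∑ p, ‖W p x‖ ^ 2 ≤ t ^ 2 * C ^ 2 := by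
      simp only [e1, ← Finset.mul_sum]
      exact mul_le_mul_of_nonneg_left (hsumG x) (sq_nonneg t)
    have e6 : 0 ≤ ∑ p, ‖W p x‖ ^ 2 := Finset.sum_nonneg fun _ _ => sq_nonneg _
    rw [signAverageBound, e3, e4]
    simp only [norm_zero]
    nlinarith [mul_le_mul_of_nonneg_right e5 e6]
  have i1 : Integrable fun x => ‖dbarA w x‖ ^ 2 :=
    integrable_of_vanish hw.compact ((continuous_dbarA hw.smooth).norm.pow 2)
      fun x hx => by simp [dbarA_eq_zero_of_notMem_tsupport hx]
  have i2 : Integrable fun x => ‖w x‖ ^ 2 :=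
    integrable_of_vanish hw.compact (hw.smooth.continuous.norm.pow 2)
      fun x hx => by simp [image_eq_zero_of_notMem_tsupport hx]
  have ih : Integrable h := ((i1.const_mul _).add (i2.const_mul _)).const_mul _
  have hint : ∫ x, ∑ p, h (x - γ p) = (2 * n + 1) ^ 2 * ∫ x, h x := by
    rw [integral_finsetSum _ fun p _ => ih.comp_sub_right (γ p)]
    simp only [integral_sub_right_eq_self h]
    rw [Finset.sum_const, Finset.card_univ, Fintype.card_prod, Fintype.card_coe, nsmul_eq_mul]
    push_cast
    rw [hJcard]
    ring
  have hh_le : ∫ x, h x ≤ -(τ * c / 4) * (b - 1) ^ 2 := by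
    have hwI : ∫ x, ‖w x‖ ^ 2 ≤ I := integral_mono i2 integrable_gaussian_prod hwG
    rw [hh, integral_const_mul, integral_add (i1.const_mul _) (i2.const_mul _),
      integral_const_mul, integral_const_mul, ht2]
    have hCI : τ * C ^ 2 * I = c / 6 := by
      rw [hτ]
      field_simp
    set m := ∫ x, ‖w x‖ ^ 2
    set d := ∫ x, ‖dbarA w x‖ ^ 2
    have hd0 : 0 ≤ d := integral_nonneg fun x => sq_nonneg _
    have h1 : b * d ≤ (1 - b) * c / 2 := (mul_le_of_le_one_left hd0 hb1.le).trans hdw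
    have h2 : (1 - b) * c ≤ (1 - b) * m := mul_le_mul_of_nonneg_left hcw hδ.le
    have h3 : (1 - b) * (τ * C ^ 2 * m) ≤ (1 - b) * (c / 6) := by
      rw [← hCI]
      gcongr
    have h4 : b * d + (b - 1 + 3 / 2 * ((1 - b) * τ) * C ^ 2) * m ≤ -((1 - b) * c / 4) := by
      linear_combination h1 + h2 + 3 / 2 * h3
    calc _ ≤ (1 - b) * τ * -((1 - b) * c / 4) := mul_le_mul_of_nonneg_left h4 (by positivity)
      _ = _ := by ring
  have hE : planeEnergy b v ≤ (2 * n + 1) ^ 2 * (-(τ * c / 4) * (b - 1) ^ 2) :=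
    calc planeEnergy b v ≤ ∫ x, ∑ p, h (x - γ p) := hvE.trans (integral_mono
            (integrable_signAverageBound hW _ (testOn_zero _))
            (integrable_finsetSum _ fun p _ => ih.comp_sub_right (γ p)) hptw)
      _ ≤ _ := by
        rw [hint]
        exact mul_le_mul_of_nonneg_left hh_le (by positivity)
  calc gfun b ≤ planeEnergy b v / (2 * (2 * n + 1)) ^ 2 := hv.gfun_le hb hR
    _ ≤ ((2 * n + 1) ^ 2 * (-(τ * c / 4) * (b - 1) ^ 2)) / (2 * (2 * n + 1)) ^ 2 := by gcongr
    _ = _ := by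
      field_simp
      ring

/-- Quadratic bounds on `g` near `b = 1`: `α(b-1)² ≤ |g(b)| ≤ (1/2)(b-1)²`. -/
theorem stmt_9 :
    ∃ α ∈ Ioo (0:ℝ) (1/2), ∀ b ∈ Icc (0:ℝ) 1,
      α * (b - 1) ^ 2 ≤ |gfun b| ∧ |gfun b| ≤ (1/2) * (b - 1) ^ 2 := by
  obtain ⟨κ, hκ, h⟩ := exists_gfun_le
  refine ⟨min κ (1 / 4), ⟨by positivity, (min_le_right _ _).trans_lt (by norm_num)⟩,
    fun b hb => ?_⟩
  rw [abs_of_nonpos (gfun_nonpos hb.1)]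
  have h1 := h b hb.1 hb.2
  have h2 := gfun_ge hb.1
  have h3 := mul_le_mul_of_nonneg_right (min_le_left κ (1 / 4)) (sq_nonneg (b - 1))
  constructor <;> linarith
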